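/- arXiv:math/0003129 — 2 statements merged into one kernel-verified Lean document; each statement's English description precedes it below -/
import Mathlib

section
/- Let n ≥ 4 and let T_1, …, T_n ∈ GL_{n+1}(ℂ) be invertible matrices satisfying the braid relations, such that the representation of B_{n+1} they define is irreducible. Suppose there exist a nonzero vector v ∈ ℂ^{n+1} and scalars x, y ∈ ℂ such that T_i v = y v for all i = 1, …, n−2 and T_n v = x v (i.e., the restriction of the representation to B_{n−1} × ⟨σ_n⟩ stabilizes the line ℂv). Then y ≠ 0 and rank(T_1 − y·I_{n+1}) = 2. -/
/-- The matrices `T 1, …, T n` satisfy the braid relations (for `B_{n+1}`). -/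
def BraidRels {r : ℕ} (m : ℕ) (T : ℕ → Matrix (Fin r) (Fin r) ℂ) : Prop :=
  (∀ i, 1 ≤ i → i + 1 ≤ m - 1 → T i * T (i + 1) * T i = T (i + 1) * T i * T (i + 1)) ∧
  (∀ i j, 1 ≤ i → i + 2 ≤ j → j ≤ m - 1 → T i * T j = T j * T i)

/-- A subspace of `ℂ^r` invariant under all of `T 1, …, T (m-1)`. -/
def BraidInvariant {r : ℕ} (m : ℕ) (T : ℕ → Matrix (Fin r) (Fin r) ℂ)
    (p : Submodule ℂ (Fin r → ℂ)) : Prop :=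
  ∀ i, 1 ≤ i → i ≤ m - 1 → ∀ v ∈ p, (T i).mulVec v ∈ p

/-- The representation of `B_m` given by `T 1, …, T (m-1)` is irreducible. -/
def BraidIrreducible {r : ℕ} (m : ℕ) (T : ℕ → Matrix (Fin r) (Fin r) ℂ) : Prop :=
  ∀ p : Submodule ℂ (Fin r → ℂ), BraidInvariant m T p → p = ⊥ ∨ p = ⊤

section BraidGroup

variable {G : Type*} [Group G]

/-- The product `t 1 * t 2 * ⋯ * t k`. -/
def initialProd (t : ℕ → G) : ℕ → G
  | 0 => 1
  | k + 1 => initialProd t k * t (k + 1)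

/-- The conjugates of `a` by the powers of `g`, indexed so that `a` has index `1`. -/
def conjFamily (g a : G) (j : ℤ) : G := g ^ (j - 1) * a * g ^ (1 - j)

theorem conjFamily_add (g a : G) (j k : ℤ) :
    conjFamily g a (j + k) = g ^ k * conjFamily g a j * (g ^ k)⁻¹ := by
  simp only [conjFamily, ← zpow_neg, mul_assoc, ← zpow_add]
  rw [← mul_assoc (g ^ k), ← zpow_add]
  congr 3 <;> ring_nf

theorem conjFamily_add_one (g a : G) (j : ℤ) :
    conjFamily g a (j + 1) = g * conjFamily g a j * g⁻¹ := by
  simpa using conjFamily_add g a j 1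

@[simp]
theorem conjFamily_one (g a : G) : conjFamily g a 1 = a := by simp [conjFamily]

/-- The elements `t 1, …, t n` of a group satisfy the braid relations. -/
structure IsBraidFamily (n : ℕ) (t : ℕ → G) : Prop where
  braid : ∀ i, 1 ≤ i → i + 1 ≤ n → t i * t (i + 1) * t i = t (i + 1) * t i * t (i + 1)
  comm : ∀ i j, 1 ≤ i → i + 2 ≤ j → j ≤ n → t i * t j = t j * t i

namespace IsBraidFamily

variable {t : ℕ → G} {n : ℕ}

theorem initialProd_comm (ht : IsBraidFamily n t) {k j : ℕ} (hkj : k + 2 ≤ j) (hj : j ≤ n) :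
    initialProd t k * t j = t j * initialProd t k := by
  induction k with
  | zero => simp [initialProd]
  | succ k ih =>
    rw [initialProd, mul_assoc, ht.comm (k + 1) j (by omega) (by omega) hj, ← mul_assoc,
      ih (by omega), mul_assoc]

theorem initialProd_mul (ht : IsBraidFamily n t) {k i : ℕ} (hk : k ≤ n) (hi : 1 ≤ i) (hik : i < k) :
    initialProd t k * t i = t (i + 1) * initialProd t k := by
  induction k with
  | zero => omega
  | succ k ih =>
    rcases Nat.lt_succ_iff_lt_or_eq.mp hik with h | rfl
    · rw [initialProd, mul_assoc, ← ht.comm i (k + 1) hi (by omega) hk, ← mul_assoc,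
        ih (by omega) h, mul_assoc]
    · obtain ⟨m, rfl⟩ := Nat.exists_eq_add_of_le' hi
      have hb := ht.braid (m + 1) hi hk
      have hc := ht.initialProd_comm (k := m) (j := m + 1 + 1) le_rfl hk
      simp only [initialProd, mul_assoc] at hb hc ⊢
      rw [hb, ← mul_assoc, hc, mul_assoc]

theorem mul_initialProd_mul (ht : IsBraidFamily n t) {k : ℕ} (hk : k < n) :
    t 1 * (initialProd t n * initialProd t k) = initialProd t (k + 1) * initialProd t n := by
  induction k with
  | zero => simp [initialProd]
  | succ k ih =>
    rw [initialProd, ← mul_assoc (initialProd t n), ← mul_assoc, ih (by omega), mul_assoc,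
      ht.initialProd_mul le_rfl (by omega) hk, ← mul_assoc, ← initialProd]

theorem conjFamily_eq (ht : IsBraidFamily n t) {i : ℕ} (hi : 1 ≤ i) (hin : i ≤ n) :
    conjFamily (initialProd t n) (t 1) i = t i := by
  induction i, hi using Nat.le_induction with
  | base => simp
  | succ i hi ih =>
    rw [Nat.cast_succ, conjFamily_add_one, ih (by omega),
      ht.initialProd_mul le_rfl hi hin, mul_inv_cancel_right]

theorem conjFamily_periodic (ht : IsBraidFamily n t) (hn : 1 ≤ n) (j : ℤ) :
    conjFamily (initialProd t n) (t 1) (j + (n + 1)) = conjFamily (initialProd t n) (t 1) j := by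
  obtain ⟨m, rfl⟩ := Nat.exists_eq_add_of_le' hn
  set g := initialProd t (m + 1) with hg
  have h : conjFamily g (t 1) ((m + 1 : ℕ) + 2) = t 1 := by
    have h1 := ht.mul_initialProd_mul (Nat.lt_succ_self m)
    have h2 : g = initialProd t m * t (m + 1) := rfl
    rw [conjFamily_add, ht.conjFamily_eq (by omega) le_rfl, mul_inv_eq_iff_eq_mul]
    rw [← hg] at h1
    calc g ^ (2 : ℤ) * t (m + 1) = g * g * t (m + 1) := by rw [zpow_two]
      _ = t 1 * g ^ (2 : ℤ) := by rw [← h1, zpow_two, mul_assoc, mul_assoc, ← h2]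
  have h3 : j + ((m + 1 : ℕ) + 1) = ((m + 1 : ℕ) + 2) + (j - 1) := by ring
  have h4 : conjFamily g (t 1) j = conjFamily g (t 1) (1 + (j - 1)) := by congr 1; ring
  rw [h3, h4, conjFamily_add _ _ _ (j - 1), conjFamily_add _ _ 1, h, conjFamily_one]

theorem conjFamily_comm (ht : IsBraidFamily n t) {i j : ℤ} (hij : i + 2 ≤ j) (hj : j + 1 ≤ i + n) :
    Commute (conjFamily (initialProd t n) (t 1) i) (conjFamily (initialProd t n) (t 1) j) := by
  obtain ⟨d, hd⟩ := Int.eq_ofNat_of_zero_le (show 0 ≤ j - i by omega)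
  have hi : i = 1 + (i - 1) := by ring
  have hj : j = ((d + 1 : ℕ) : ℤ) + (i - 1) := by push_cast; omega
  rw [hi, hj, conjFamily_add, conjFamily_add, ht.conjFamily_eq (by omega) (by omega),
    conjFamily_one, Commute.conj_iff]
  exact ht.comm 1 (d + 1) le_rfl (by omega) (by omega)

theorem conjFamily_braid (ht : IsBraidFamily n t) (hn : 2 ≤ n) (i : ℤ) :
    let S := conjFamily (initialProd t n) (t 1)
    S i * S (i + 1) * S i = S (i + 1) * S i * S (i + 1) := by
  intro S
  have hi : i = 1 + (i - 1) := by ring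
  have hi' : i + 1 = ((2 : ℕ) : ℤ) + (i - 1) := by push_cast; ring
  have h1 : S i = _ := (congrArg S hi).trans (conjFamily_add _ _ _ _)
  have h2 : S (i + 1) = _ := (congrArg S hi').trans (conjFamily_add _ _ _ _)
  rw [h1, h2, ht.conjFamily_eq (by omega) (by omega), conjFamily_one]
  simpa [mul_assoc] using congrArg
    (fun z => initialProd t n ^ (i - 1) * z * (initialProd t n ^ (i - 1))⁻¹) (ht.braid 1 le_rfl hn)

end IsBraidFamily

end BraidGroup

section Orbit

open Module Submodule

variable {K V : Type*} [Field K] [AddCommGroup V] [Module K V]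

/-- A family of `k` consecutive vectors is independent, or some vector of it lies in the span
of its predecessors. -/
theorem linearIndepOn_Ico_or_exists_mem_span (u : ℤ → V) (p : ℤ) (k : ℕ) :
    LinearIndepOn K u (Set.Ico p (p + k)) ∨
      ∃ m < k, u (p + m) ∈ span K (u '' Set.Ico p (p + m)) := by
  induction k with
  | zero => left; simp
  | succ k ih =>
    rcases ih with h | ⟨m, hm, h⟩
    · by_cases hk : u (p + k) ∈ span K (u '' Set.Ico p (p + k))
      · exact .inr ⟨k, by omega, hk⟩
      · left
        convert h.insert hk using 1
        ext j
        simp only [Set.mem_Ico, Set.mem_insert_iff]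
        omega
    · exact .inr ⟨m, by omega, h⟩

theorem apply_mem_iff_of_map_eq {τ : V ≃ₗ[K] V} {P : Submodule K V}
    (hP : P.map τ.toLinearMap = P) (z : V) : τ z ∈ P ↔ z ∈ P := by
  nth_rewrite 1 [← hP]
  rw [← LinearEquiv.coe_coe, mem_map]
  simp

/-- The sequence `u` is an orbit of the automorphism `τ`. -/
def IsOrbit (τ : V ≃ₗ[K] V) (u : ℤ → V) : Prop := ∀ j, τ (u j) = u (j + 1)

namespace IsOrbit

variable {τ : V ≃ₗ[K] V} {u : ℤ → V}

theorem image_Ico (hu : IsOrbit τ u) (p q : ℤ) :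
    τ '' (u '' Set.Ico p q) = u '' Set.Ico (p + 1) (q + 1) := by
  have h : ∀ s : Set ℤ, τ '' (u '' s) = u '' ((· + 1) '' s) := fun s => by
    simp only [Set.image_image, hu _]
  rw [h, Set.image_add_const_Ico]

theorem map_span_Ico (hu : IsOrbit τ u) (p q : ℤ) :
    (span K (u '' Set.Ico p q)).map τ.toLinearMap = span K (u '' Set.Ico (p + 1) (q + 1)) := by
  rw [map_span, LinearEquiv.coe_coe, hu.image_Ico]

theorem mem_span_Ico_add_one_iff (hu : IsOrbit τ u) (p q r : ℤ) :
    u (r + 1) ∈ span K (u '' Set.Ico (p + 1) (q + 1)) ↔ u r ∈ span K (u '' Set.Ico p q) := by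
  rw [← hu.map_span_Ico, ← hu, ← LinearEquiv.coe_coe, mem_map]
  simp

theorem map_span_range (hu : IsOrbit τ u) :
    (span K (Set.range u)).map τ.toLinearMap = span K (Set.range u) := by
  rw [map_span, LinearEquiv.coe_coe, ← Set.range_comp]
  congr 1
  ext z
  constructor
  · rintro ⟨j, rfl⟩
    exact ⟨j + 1, (hu j).symm⟩
  · rintro ⟨j, rfl⟩
    exact ⟨j - 1, by simp [hu _]⟩

theorem span_Ico_eq_span_range [FiniteDimensional K V] (hu : IsOrbit τ u) {p : ℤ} {m : ℕ}
    (hm : u (p + m) ∈ span K (u '' Set.Ico p (p + m))) (q : ℤ) :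
    span K (u '' Set.Ico q (q + m)) = span K (Set.range u) := by
  have hall : ∀ q : ℤ, u (q + m) ∈ span K (u '' Set.Ico q (q + m)) := by
    intro q
    induction q using Int.inductionOn' (b := p) with
    | zero => exact hm
    | succ k _ ih =>
      have := (hu.mem_span_Ico_add_one_iff k (k + m) (k + m)).2 ih
      rwa [add_right_comm] at this
    | pred k _ ih =>
      refine (hu.mem_span_Ico_add_one_iff (k - 1) (k - 1 + m) (k - 1 + m)).1 ?_
      rwa [show k - 1 + m + 1 = k + m by ring, sub_add_cancel]
  have hstep : ∀ q : ℤ, span K (u '' Set.Ico (q + 1) (q + 1 + m)) =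
      span K (u '' Set.Ico q (q + m)) := by
    intro q
    refine eq_of_le_of_finrank_eq (span_le.2 ?_) ?_
    · rintro _ ⟨j, hj, rfl⟩
      obtain rfl | h := eq_or_ne j (q + m)
      · exact hall q
      · exact subset_span ⟨j, by simp only [Set.mem_Ico] at hj ⊢; omega, rfl⟩
    · rw [add_right_comm, ← hu.map_span_Ico, LinearEquiv.finrank_map_eq]
  have hconst : ∀ q : ℤ, span K (u '' Set.Ico q (q + m)) = span K (u '' Set.Ico 0 (0 + m)) := by
    intro q
    induction q using Int.induction_on with
    | zero => rfl
    | succ k ih => rw [hstep, ih]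
    | pred k ih => rw [← ih, ← hstep, sub_add_cancel]
  refine le_antisymm (span_mono (Set.image_subset_range _ _)) (span_le.2 ?_)
  rintro _ ⟨j, rfl⟩
  have := hall (j - m)
  rwa [hconst, ← hconst q, sub_add_cancel] at this

/-- Either `k + 1` consecutive vectors of an orbit are independent, or any `k` consecutive ones
span the whole orbit. -/
theorem linearIndepOn_or_span_eq [FiniteDimensional K V] (hu : IsOrbit τ u) (p : ℤ) (k : ℕ) :
    LinearIndepOn K u (Set.Ico p (p + (k + 1))) ∨
      ∀ q : ℤ, span K (u '' Set.Ico q (q + k)) = span K (Set.range u) := by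
  rcases linearIndepOn_Ico_or_exists_mem_span (K := K) u p (k + 1) with h | ⟨m, hm, h⟩
  · exact .inl (by exact_mod_cast h)
  · refine .inr fun q => le_antisymm (span_mono (Set.image_subset_range _ _)) ?_
    rw [← hu.span_Ico_eq_span_range h q]
    exact span_mono (Set.image_mono (Set.Ico_subset_Ico_right (by omega)))

end IsOrbit

theorem finrank_span_image_Ico_le (u : ℤ → V) (q : ℤ) (k : ℕ) :
    finrank K (span K (u '' Set.Ico q (q + k))) ≤ k := by
  classical
  rw [← Finset.coe_Ico, ← Finset.coe_image]
  refine (finrank_span_finset_le_card _).trans (Finset.card_image_le.trans ?_)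
  simp

theorem LinearIndepOn.finrank_span_image_Ico {u : ℤ → V} {q : ℤ} {k : ℕ}
    (h : LinearIndepOn K u (Set.Ico q (q + k))) :
    finrank K (span K (u '' Set.Ico q (q + k))) = k := by
  rw [Set.image_eq_range, finrank_span_eq_card h]
  simp

end Orbit

section CyclicBraidOrbit

open Module Submodule

variable {K V : Type*} [Field K] [AddCommGroup V] [Module K V]

/-- The endomorphism `f - y`. -/
def shiftBy (y : K) (f : V ≃ₗ[K] V) : V →ₗ[K] V := f.toLinearMap - y • LinearMap.id

theorem shiftBy_apply (y : K) (f : V ≃ₗ[K] V) (z : V) : shiftBy y f z = f z - y • z := rfl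

/-- Automorphisms `S i` (`i` modulo `n + 1`) satisfying the braid relations in cyclic form and
generating an irreducible representation of dimension `n + 1`, permuted cyclically by conjugation
with `τ`, together with a `τ`-orbit `u` such that `u j` is an eigenvector of `S i` for every
`i ≠ j ± 1`. -/
structure IsCyclicBraidOrbit (n : ℕ) (τ : V ≃ₗ[K] V) (S : ℤ → V ≃ₗ[K] V) (u : ℤ → V) (x y : K) :
    Prop where
  conj : ∀ i z, τ (S i z) = S (i + 1) (τ z)
  periodic : ∀ i, S (i + (n + 1)) = S i
  comm : ∀ i j : ℤ, i + 2 ≤ j → j + 1 ≤ i + n → ∀ z, S i (S j z) = S j (S i z)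
  braid : ∀ i z, S i (S (i + 1) (S i z)) = S (i + 1) (S i (S (i + 1) z))
  orbit : IsOrbit τ u
  fix : ∀ i j : ℤ, j + 2 ≤ i → i + 1 ≤ j + n → S i (u j) = y • u j
  eig : ∀ j, S j (u j) = x • u j
  irred : ∀ P : Submodule K V, (∀ i : ℤ, 1 ≤ i → i ≤ n → ∀ z ∈ P, S i z ∈ P) → P = ⊥ ∨ P = ⊤
  finrank_eq : finrank K V = n + 1
  ne_zero : ∀ j, u j ≠ 0

namespace IsCyclicBraidOrbit

variable {n : ℕ} {τ : V ≃ₗ[K] V} {S : ℤ → V ≃ₗ[K] V} {u : ℤ → V} {x y : K}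

theorem shiftBy_conj (h : IsCyclicBraidOrbit n τ S u x y) (i : ℤ) (z : V) :
    τ (shiftBy y (S i) z) = shiftBy y (S (i + 1)) (τ z) := by
  simp [shiftBy_apply, h.conj]

theorem shiftBy_comm (h : IsCyclicBraidOrbit n τ S u x y) {i j : ℤ} (hij : i + 2 ≤ j)
    (hj : j + 1 ≤ i + n) (z : V) :
    shiftBy y (S i) (shiftBy y (S j) z) = shiftBy y (S j) (shiftBy y (S i) z) := by
  simp only [shiftBy_apply, map_sub, map_smul, h.comm i j hij hj]
  module

theorem shiftBy_fix (h : IsCyclicBraidOrbit n τ S u x y) {i j : ℤ} (hij : j + 2 ≤ i)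
    (hi : i + 1 ≤ j + n) : shiftBy y (S i) (u j) = 0 := by
  rw [shiftBy_apply, h.fix i j hij hi, sub_self]

theorem shiftBy_fix' (h : IsCyclicBraidOrbit n τ S u x y) {i j : ℤ} (hij : i + 2 ≤ j)
    (hj : j + 1 ≤ i + n) : shiftBy y (S i) (u j) = 0 := by
  rw [← h.periodic]
  exact h.shiftBy_fix (by omega) (by omega)

theorem mem_of_shiftBy_zero_mem (h : IsCyclicBraidOrbit n τ S u x y)
    {P : Submodule K V} (hτ : P.map τ.toLinearMap = P) (h0 : ∀ z ∈ P, shiftBy y (S 0) z ∈ P)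
    (i : ℤ) : ∀ z ∈ P, shiftBy y (S i) z ∈ P := by
  have hmem := apply_mem_iff_of_map_eq hτ
  induction i using Int.induction_on with
  | zero => exact h0
  | succ k ih =>
    intro z hz
    obtain ⟨w, rfl⟩ := τ.surjective z
    rw [← h.shiftBy_conj, hmem]
    exact ih w ((hmem w).1 hz)
  | pred k ih =>
    intro z hz
    rw [← hmem, h.shiftBy_conj, sub_add_cancel]
    exact ih _ ((hmem z).2 hz)

theorem span_range_eq_top (h : IsCyclicBraidOrbit n τ S u x y)
    (h0 : ∀ z ∈ span K (Set.range u), shiftBy y (S 0) z ∈ span K (Set.range u)) :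
    span K (Set.range u) = ⊤ := by
  refine (h.irred _ fun i _ _ z hz => ?_).resolve_left fun hbot => ?_
  · have := h.mem_of_shiftBy_zero_mem h.orbit.map_span_range h0 i z hz
    rw [shiftBy_apply] at this
    simpa using add_mem this (smul_mem _ y hz)
  · exact h.ne_zero 0 ((Submodule.eq_bot_iff _).1 hbot _ (subset_span ⟨0, rfl⟩))

theorem exists_shiftBy_mem_span_singleton [FiniteDimensional K V]
    (h : IsCyclicBraidOrbit n τ S u x y)
    (h0 : finrank K (LinearMap.range (shiftBy y (S 1))) ≤ 1) (i : ℕ) :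
    ∃ w, ∀ z, shiftBy y (S (i + 1)) z ∈ span K {w} := by
  induction i with
  | zero =>
    obtain ⟨w, hw⟩ := finrank_le_one_iff.1 h0
    refine ⟨w, fun z => ?_⟩
    obtain ⟨c, hc⟩ := hw ⟨_, LinearMap.mem_range_self _ z⟩
    rw [Nat.cast_zero, zero_add]
    exact mem_span_singleton.2 ⟨c, congrArg Subtype.val hc⟩
  | succ k ih =>
    obtain ⟨w, hw⟩ := ih
    refine ⟨τ w, fun z => ?_⟩
    obtain ⟨z, rfl⟩ := τ.surjective z
    rw [Nat.cast_succ, ← h.shiftBy_conj]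
    obtain ⟨c, hc⟩ := mem_span_singleton.1 (hw z)
    exact mem_span_singleton.2 ⟨c, by rw [← hc, map_smul]⟩

theorem two_le_finrank_range [FiniteDimensional K V] (h : IsCyclicBraidOrbit n τ S u x y)
    (hn : 1 ≤ n) : 2 ≤ finrank K (LinearMap.range (shiftBy y (S 1))) := by
  by_contra! hlt
  choose w hw using h.exists_shiftBy_mem_span_singleton (Nat.le_of_lt_succ hlt)
  have hS : ∀ P : Submodule K V, (∀ i : ℤ, 1 ≤ i → i ≤ n → ∀ z ∈ P, shiftBy y (S i) z ∈ P) →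
      P = ⊥ ∨ P = ⊤ := fun P hP => h.irred P fun i hi hin z hz => by
    simpa [shiftBy_apply] using add_mem (hP i hi hin z hz) (smul_mem _ y hz)
  set P := span K (Set.range fun i : Fin n => w i) with hPdef
  have hP : ∀ i : ℤ, 1 ≤ i → i ≤ n → ∀ z, shiftBy y (S i) z ∈ P := by
    intro i hi hin z
    obtain ⟨k, hk⟩ := Int.eq_ofNat_of_zero_le (show 0 ≤ i - 1 by omega)
    obtain rfl : i = k + 1 := by omega
    refine span_mono ?_ (hw k z)
    rintro _ rfl
    exact ⟨⟨k, by omega⟩, rfl⟩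
  have hPrank : finrank K P ≤ n :=
    (finrank_range_le_card (R := K) fun i : Fin n => w i).trans_eq (Fintype.card_fin n)
  rcases hS P fun i hi hin z _ => hP i hi hin z with hbot | htop
  · rcases hS (span K {u 0}) fun i hi hin z _ => by
      have := hP i hi hin z
      rw [hbot, mem_bot] at this
      rw [this]
      exact zero_mem _ with h1 | h1
    · exact h.ne_zero 0 (span_singleton_eq_bot.1 h1)
    · have := finrank_span_singleton (K := K) (h.ne_zero 0)
      rw [h1, finrank_top, h.finrank_eq] at this
      omega
  · rw [htop, finrank_top, h.finrank_eq] at hPrank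
    omega

/-- The bound on the rank when the orbit does not span. -/
theorem finrank_range_le_two_of_ne_top [FiniteDimensional K V]
    (h : IsCyclicBraidOrbit n τ S u x y) (hn : 4 ≤ n) (hP : span K (Set.range u) ≠ ⊤) :
    finrank K (LinearMap.range (shiftBy y (S 0))) ≤ 2 := by
  set P := span K (Set.range u) with hPdef
  have hlt : finrank K P < n + 1 := h.finrank_eq ▸ Submodule.finrank_lt hP
  have hspan : ∀ q : ℤ, span K (u '' Set.Ico q (q + n)) = P := by
    refine (h.orbit.linearIndepOn_or_span_eq 0 n).resolve_left fun hind => ?_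
    have h1 := LinearIndepOn.finrank_span_image_Ico (k := n + 1) (by exact_mod_cast hind)
    have h2 := finrank_mono (span_mono (R := K) (Set.image_subset_range u
      (Set.Ico 0 (0 + ((n + 1 : ℕ) : ℤ)))))
    rw [← hPdef] at h2
    omega
  have hw : shiftBy y (S 0) (u 1) ∉ P := by
    refine fun hmem => hP (h.span_range_eq_top fun z hz => ?_)
    rw [← hPdef, ← hspan 0] at hz
    refine (span_le (p := P.comap (shiftBy y (S 0)))).2 ?_ hz
    rintro _ ⟨j, hj, rfl⟩
    simp only [Set.mem_Ico] at hj
    rw [SetLike.mem_coe, mem_comap]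
    obtain rfl | rfl | hj2 : j = 0 ∨ j = 1 ∨ 2 ≤ j := by omega
    · rw [shiftBy_apply, h.eig, ← sub_smul]
      exact smul_mem _ _ (subset_span ⟨0, rfl⟩)
    · exact hmem
    · rw [h.shiftBy_fix' (by omega) (by omega)]
      exact zero_mem _
  have hτ := apply_mem_iff_of_map_eq h.orbit.map_span_range
  have hw2 : shiftBy y (S 2) (u 3) ∉ P := by
    rw [← hτ, ← hτ, h.shiftBy_conj, h.shiftBy_conj, h.orbit, h.orbit] at hw
    exact hw
  have hker : shiftBy y (S 0) (shiftBy y (S 2) (u 3)) = 0 := by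
    rw [h.shiftBy_comm (by omega) (by omega), h.shiftBy_fix' (by omega) (by omega), map_zero]
  have hfix : span K (u '' Set.Ico 2 (2 + (n - 2 : ℕ))) ≤ LinearMap.ker (shiftBy y (S 0)) := by
    rw [span_le]
    rintro _ ⟨j, hj, rfl⟩
    simp only [Set.mem_Ico] at hj
    exact h.shiftBy_fix' (by omega) (by omega)
  rcases h.orbit.linearIndepOn_or_span_eq 2 (n - 3) with hind | hs
  · rw [show ((n - 3 : ℕ) : ℤ) + 1 = (n - 2 : ℕ) by omega] at hind
    have h1 := hind.finrank_span_image_Ico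
    have hlt : span K (u '' Set.Ico 2 (2 + (n - 2 : ℕ))) < LinearMap.ker (shiftBy y (S 0)) :=
      lt_of_le_of_ne hfix fun he => hw2 (span_mono (Set.image_subset_range _ _)
        (he ▸ LinearMap.mem_ker.2 hker))
    have h2 := finrank_lt_finrank_of_lt hlt
    have h3 := LinearMap.finrank_range_add_finrank_ker (shiftBy y (S 0))
    rw [h.finrank_eq] at h3
    omega
  · refine absurd (h.span_range_eq_top fun z hz => ?_) hP
    rw [← hs 2] at hz
    have := hfix (span_mono (Set.image_mono (Set.Ico_subset_Ico_right (by omega))) hz)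
    rw [LinearMap.mem_ker.1 this]
    exact zero_mem _

theorem shiftBy_combination_eq_zero (h : IsCyclicBraidOrbit n τ S u x y)
    (h0 : ∀ a b c : K, shiftBy y (S 0) (a • u (-1) + b • u 0 + c • u 1) = 0 →
      a = 0 ∧ b = 0 ∧ c = 0) (i : ℤ) (a b c : K)
    (hi : shiftBy y (S i) (a • u (i - 1) + b • u i + c • u (i + 1)) = 0) :
    a = 0 ∧ b = 0 ∧ c = 0 := by
  induction i using Int.induction_on with
  | zero => exact h0 a b c (by simpa using hi)
  | succ k ih =>
    refine ih ?_
    rw [← τ.map_eq_zero_iff, h.shiftBy_conj]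
    simpa [h.orbit _] using hi
  | pred k ih =>
    refine ih ?_
    rw [← τ.map_eq_zero_iff, h.shiftBy_conj] at hi
    simpa [h.orbit _] using hi

theorem eq_pair_of_shiftBy_eq_zero (h : IsCyclicBraidOrbit n τ S u x y)
    (hn : 4 ≤ n)
    (hinj : ∀ (i : ℤ) (a b c : K), shiftBy y (S i) (a • u (i - 1) + b • u i + c • u (i + 1)) = 0 →
      a = 0 ∧ b = 0 ∧ c = 0)
    {q : ℤ} (hq : span K (u '' Set.Ico q (q + (n + 1))) = ⊤) {z : V}
    (hz : ∀ i, q + 3 ≤ i → i + 1 ≤ q + n → shiftBy y (S i) z = 0) :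
    ∃ a b : K, z = a • u q + b • u (q + 1) := by
  have hmem : z ∈ span K (u '' (Finset.Ico q (q + (n + 1)) : Finset ℤ)) := by
    rw [Finset.coe_Ico, hq]
    trivial
  obtain ⟨c, hc⟩ := (Submodule.mem_span_image_finset_iff_exists_fun' K).1 hmem
  have hcoef : ∀ i, q + 3 ≤ i → i + 1 ≤ q + n → c (i - 1) = 0 ∧ c i = 0 ∧ c (i + 1) = 0 := by
    intro i hi1 hi2
    apply hinj i
    have hsum : ∑ j ∈ {i - 1, i, i + 1}, c j • shiftBy y (S i) (u j) = shiftBy y (S i) z := by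
      rw [← hc, map_sum]
      simp only [map_smul]
      refine Finset.sum_subset ?_ ?_
      · intro j hj
        simp only [Finset.mem_insert, Finset.mem_singleton, Finset.mem_Ico] at hj ⊢
        omega
      · intro j hj hj'
        simp only [Finset.mem_insert, Finset.mem_singleton, Finset.mem_Ico, not_or] at hj hj'
        obtain hlt | hlt : j + 2 ≤ i ∨ i + 2 ≤ j := by omega
        · rw [h.shiftBy_fix hlt (by omega), smul_zero]
        · rw [h.shiftBy_fix' hlt (by omega), smul_zero]
    rw [hz i hi1 hi2, Finset.sum_insert, Finset.sum_pair (by omega)] at hsum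
    · simpa [add_assoc] using hsum
    · simp only [Finset.mem_insert, Finset.mem_singleton]
      omega
  refine ⟨c q, c (q + 1), ?_⟩
  have hpair : ∑ j ∈ {q, q + 1}, c j • u j = z := by
    rw [← hc]
    refine Finset.sum_subset ?_ ?_
    · intro j hj
      simp only [Finset.mem_insert, Finset.mem_singleton, Finset.mem_Ico] at hj ⊢
      omega
    · intro j hj hj'
      simp only [Finset.mem_insert, Finset.mem_singleton, Finset.mem_Ico, not_or] at hj hj'
      suffices c j = 0 by rw [this, zero_smul]
      obtain hj1 | hj1 | hj1 : j = q + 2 ∨ j = q + n ∨ (q + 3 ≤ j ∧ j + 1 ≤ q + n) := by omega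
      · simpa [hj1, add_sub_assoc] using (hcoef (q + 3) (by omega) (by omega)).1
      · simpa [hj1] using (hcoef (q + n - 1) (by omega) (by omega)).2.2
      · exact (hcoef j hj1.1 hj1.2).2.1
  rw [← hpair, Finset.sum_pair (by omega)]

/-- The bound on the rank when the orbit spans. -/
theorem finrank_range_le_two_of_eq_top [FiniteDimensional K V]
    (h : IsCyclicBraidOrbit n τ S u x y) (hn : 4 ≤ n) (hP : span K (Set.range u) = ⊤) :
    finrank K (LinearMap.range (shiftBy y (S 0))) ≤ 2 := by
  by_contra! hlt
  have hspan : ∀ q : ℤ, span K (u '' Set.Ico q (q + (n + 1))) = ⊤ := by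
    intro q
    refine eq_top_of_finrank_eq ?_
    rw [h.finrank_eq]
    rcases h.orbit.linearIndepOn_or_span_eq q n with hind | hs
    · exact_mod_cast LinearIndepOn.finrank_span_image_Ico (k := n + 1) (by exact_mod_cast hind)
    · have := finrank_span_image_Ico_le (K := K) u q n
      rw [hs q, hP, finrank_top, h.finrank_eq] at this
      omega
  have h0 : ∀ a b c : K, shiftBy y (S 0) (a • u (-1) + b • u 0 + c • u 1) = 0 →
      a = 0 ∧ b = 0 ∧ c = 0 := by
    have hle : LinearMap.range (shiftBy y (S 0)) ≤ span K (Set.range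
        ![shiftBy y (S 0) (u (-1)), shiftBy y (S 0) (u 0), shiftBy y (S 0) (u 1)]) := by
      rw [LinearMap.range_eq_map, ← hspan (-1), map_span, span_le]
      rintro _ ⟨_, ⟨j, hj, rfl⟩, rfl⟩
      simp only [Set.mem_Ico] at hj
      obtain rfl | rfl | rfl | hj2 : j = -1 ∨ j = 0 ∨ j = 1 ∨ 2 ≤ j := by omega
      · exact subset_span ⟨0, rfl⟩
      · exact subset_span ⟨1, rfl⟩
      · exact subset_span ⟨2, rfl⟩
      · rw [h.shiftBy_fix' (j := j) (by omega) (by omega)]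
        exact zero_mem _
    have hind := linearIndependent_iff_card_le_finrank_span.2
      (show Fintype.card (Fin 3) ≤ _ from (Nat.succ_le_of_lt hlt).trans (finrank_mono hle))
    intro a b c habc
    have := Fintype.linearIndependent_iff.1 hind ![a, b, c]
      (by simpa [Fin.sum_univ_three] using habc)
    exact ⟨this 0, this 1, this 2⟩
  have hli : ∀ a b c : K, a • u (-1) + b • u 0 + c • u 1 = 0 → a = 0 ∧ b = 0 ∧ c = 0 :=
    fun a b c habc => h0 a b c (by rw [habc, map_zero])
  have hinj := h.shiftBy_combination_eq_zero h0
  have hy : y ≠ 0 := by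
    rintro rfl
    have := h.fix 2 0 (by omega) (by omega)
    rw [zero_smul, LinearEquiv.map_eq_zero_iff] at this
    exact h.ne_zero 0 this
  have hx : x ≠ 0 := by
    rintro rfl
    have := h.eig 0
    rw [zero_smul, LinearEquiv.map_eq_zero_iff] at this
    exact h.ne_zero 0 this
  obtain ⟨a, e, hae⟩ := h.eq_pair_of_shiftBy_eq_zero hn hinj (hspan (-1))
    (z := shiftBy y (S 0) (u (-1))) fun i hi1 hi2 => by
      rw [← h.shiftBy_comm (by omega) (by omega), h.shiftBy_fix (by omega) (by omega), map_zero]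
  obtain ⟨b, f, hbf⟩ := h.eq_pair_of_shiftBy_eq_zero hn hinj (hspan 0)
    (z := shiftBy y (S 0) (u 1)) fun i hi1 hi2 => by
      rw [← h.shiftBy_comm (by omega) (by omega), h.shiftBy_fix (by omega) (by omega), map_zero]
  rw [zero_add] at hbf
  rw [neg_add_cancel] at hae
  have hS1 : S 0 (u (-1)) = (a + y) • u (-1) + e • u 0 := by
    rw [shiftBy_apply, sub_eq_iff_eq_add] at hae
    rw [hae]
    module
  have hS2 : S 1 (u 0) = (a + y) • u 0 + e • u 1 := by
    simpa [h.conj, h.orbit _] using congrArg τ hS1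
  have hS3 : S 0 (u 1) = (f + y) • u 1 + b • u 0 := by
    rw [shiftBy_apply, sub_eq_iff_eq_add] at hbf
    rw [hbf]
    module
  have hS4 : S 1 (u (-1)) = y • u (-1) := h.fix _ _ (by omega) (by omega)
  have hbr := h.braid 0 (u (-1))
  rw [zero_add] at hbr
  simp only [hS1, hS2, hS3, hS4, h.eig, map_add, map_smul] at hbr
  have hc : (a + y) * (a + y) * y - (a + y) * y * y = 0 := by
    refine (hli _ (e * b * e + e * (a + y) * x + (a + y) * y * e - y * (e * (a + y)))
      (e * e * (f + y) - y * (e * e)) ?_).1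
    rw [← sub_eq_zero] at hbr
    rw [← hbr]
    module
  have hc' : (a + y) * a * y = 0 := by linear_combination hc
  rcases mul_eq_zero.1 (mul_eq_zero.1 hc' |>.resolve_right hy) with ha | rfl
  · rw [ha, zero_smul, zero_add] at hS1
    have : x • u (-1) - e • u 0 = 0 := by
      rw [← (S 0).map_eq_zero_iff, map_sub, map_smul, map_smul, hS1, h.eig, smul_comm, sub_self]
    refine hx (hli x (-e) 0 ?_).1
    rw [← this]
    module
  · have he : x - y = 0 ∧ -e = 0 ∧ (0 : K) = 0 := by
      refine h0 _ _ _ ?_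
      rw [map_add, map_add, map_smul, map_smul, hae, shiftBy_apply y (S 0) (u 0), h.eig]
      simp only [zero_smul, map_zero]
      module
    rw [neg_eq_zero.1 he.2.1, zero_smul, zero_smul, add_zero] at hae
    exact one_ne_zero (h0 1 0 0 (by simp [hae])).1

theorem finrank_range_eq_two [FiniteDimensional K V]
    (h : IsCyclicBraidOrbit n τ S u x y) (hn : 4 ≤ n) :
    finrank K (LinearMap.range (shiftBy y (S 1))) = 2 := by
  refine le_antisymm ?_ (h.two_le_finrank_range (by omega))
  have hcomp : shiftBy y (S 1) ∘ₗ τ.toLinearMap = τ.toLinearMap ∘ₗ shiftBy y (S 0) :=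
    LinearMap.ext fun z => (h.shiftBy_conj 0 z).symm
  rw [← LinearEquiv.range_comp τ, hcomp, LinearMap.range_comp, LinearEquiv.finrank_map_eq]
  by_cases hP : span K (Set.range u) = ⊤
  · exact h.finrank_range_le_two_of_eq_top hn hP
  · exact h.finrank_range_le_two_of_ne_top hn hP

end IsCyclicBraidOrbit
end CyclicBraidOrbit

section Construction

open Module Submodule

variable {K V : Type*} [Field K] [AddCommGroup V] [Module K V]

theorem conjFamily_mul_zpow {G : Type*} [Group G] (g a : G) (i k : ℤ) :
    conjFamily g a i * g ^ k = g ^ k * conjFamily g a (i - k) := by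
  rw [eq_comm, ← mul_inv_eq_iff_eq_mul, ← conjFamily_add, sub_add_cancel]

/-- A common eigenvector of `t 1, …, t (n - 2)` and `t n` gives rise to a cyclic orbit. -/
theorem IsBraidFamily.isCyclicBraidOrbit {n : ℕ} {t : ℕ → V ≃ₗ[K] V} (ht : IsBraidFamily n t)
    (hn : 2 ≤ n) (hrank : finrank K V = n + 1)
    (hirr : ∀ P : Submodule K V, (∀ i, 1 ≤ i → i ≤ n → ∀ z ∈ P, t i z ∈ P) → P = ⊥ ∨ P = ⊤)
    {v : V} (hv : v ≠ 0) {x y : K} (hy : ∀ i, 1 ≤ i → i ≤ n - 2 → t i v = y • v)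
    (hx : t n v = x • v) :
    IsCyclicBraidOrbit n (initialProd t n) (conjFamily (initialProd t n) (t 1))
      (fun j => (initialProd t n ^ (j - n)) v) x y := by
  set g := initialProd t n with hg
  have hzpow : ∀ (i k : ℤ), conjFamily g (t 1) i ((g ^ k) v) =
      (g ^ k) (conjFamily g (t 1) (i - k) v) := fun i k =>
    LinearEquiv.congr_fun (conjFamily_mul_zpow g (t 1) i k) v
  refine ⟨fun i z => ?_, ht.conjFamily_periodic (by omega), fun i j hij hj z => ?_,
    fun i z => ?_, fun j => ?_, fun i j hij hi => ?_, fun j => ?_, fun P hP => ?_, hrank,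
    fun j => ?_⟩
  · have := mul_inv_eq_iff_eq_mul.1 (conjFamily_add_one g (t 1) i).symm
    exact LinearEquiv.congr_fun this z
  · exact LinearEquiv.congr_fun (ht.conjFamily_comm hij hj) z
  · exact LinearEquiv.congr_fun (ht.conjFamily_braid hn i) z
  · have : g ^ (j + 1 - n : ℤ) = g * g ^ (j - n : ℤ) := by
      rw [← zpow_one_add]
      congr 1
      ring
    exact (LinearEquiv.congr_fun this v).symm
  · obtain ⟨k, hk⟩ := Int.eq_ofNat_of_zero_le (show 0 ≤ i - j - 1 by omega)
    have hidx : i - (j - n) = k + (n + 1) := by omega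
    simp only [hzpow, hidx]
    rw [ht.conjFamily_periodic (by omega), ht.conjFamily_eq (by omega) (by omega),
      hy k (by omega) (by omega), map_smul]
  · simp only [hzpow, sub_sub_cancel]
    rw [ht.conjFamily_eq (by omega) le_rfl, hx, map_smul]
  · refine hirr P fun i hi hin z hz => ?_
    rw [← ht.conjFamily_eq hi hin]
    exact hP i (by omega) (by omega) z hz
  · simpa using hv

end Construction

/-- If an irreducible `(n+1)`-dimensional representation of `B_{n+1}` (with `n ≥ 4`)
restricted to `B_{n-1} × ⟨σ_n⟩` stabilizes a line `ℂv`, with `T i v = y v` for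
`i = 1, …, n-2` and `T n v = x v`, then `y ≠ 0` and `rank (T 1 - y I) = 2`. -/
theorem corank_two_of_stable_line (n : ℕ) (hn : 4 ≤ n)
    (T : ℕ → Matrix (Fin (n + 1)) (Fin (n + 1)) ℂ)
    (hunit : ∀ i, 1 ≤ i → i ≤ n → IsUnit (T i))
    (hbr : BraidRels (n + 1) T)
    (hirr : BraidIrreducible (n + 1) T)
    (v : Fin (n + 1) → ℂ) (hv : v ≠ 0) (x y : ℂ)
    (hy : ∀ i, 1 ≤ i → i ≤ n - 2 → (T i).mulVec v = y • v)
    (hx : (T n).mulVec v = x • v) :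
    y ≠ 0 ∧ (T 1 - y • (1 : Matrix (Fin (n + 1)) (Fin (n + 1)) ℂ)).rank = 2 := by
  have hex : ∀ i, ∃ f : (Fin (n + 1) → ℂ) ≃ₗ[ℂ] (Fin (n + 1) → ℂ),
      1 ≤ i → i ≤ n → ∀ z, f z = (T i).mulVec z := fun i => by
    by_cases hi : 1 ≤ i ∧ i ≤ n
    · exact ⟨Matrix.toLinearEquiv' (T i) (hunit i hi.1 hi.2).invertible, fun _ _ _ => rfl⟩
    · exact ⟨LinearEquiv.refl _ _, fun h1 h2 => absurd ⟨h1, h2⟩ hi⟩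
  choose t htT using hex
  have ht : IsBraidFamily n t := by
    refine ⟨fun i hi hin => LinearEquiv.ext fun z => ?_, fun i j hi hij hj =>
      LinearEquiv.ext fun z => ?_⟩
    · simpa [htT i hi (by omega), htT (i + 1) (by omega) hin, Matrix.mulVec_mulVec, mul_assoc]
        using congrArg (Matrix.mulVec · z) (hbr.1 i hi hin)
    · simpa [htT i hi (by omega), htT j (by omega) hj, Matrix.mulVec_mulVec]
        using congrArg (Matrix.mulVec · z) (hbr.2 i j hi hij hj)
  have horbit := ht.isCyclicBraidOrbit (by omega) (by simp)
    (fun P hP => hirr P fun i hi hin z hz => htT i hi hin z ▸ hP i hi hin z hz) hv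
    (fun i hi hin => (htT i hi (by omega) v).trans (hy i hi hin))
    ((htT n (by omega) le_rfl v).trans hx)
  refine ⟨?_, ?_⟩
  · rintro rfl
    have h1 := hy 1 le_rfl (by omega)
    rw [← htT 1 le_rfl (by omega), zero_smul, LinearEquiv.map_eq_zero_iff] at h1
    exact hv h1
  · have hrange := horbit.finrank_range_eq_two hn
    rw [conjFamily_one] at hrange
    have hlin : (T 1 - y • (1 : Matrix (Fin (n + 1)) (Fin (n + 1)) ℂ)).mulVecLin =
        shiftBy y (t 1) := LinearMap.ext fun z => by
      simp [shiftBy_apply, htT 1 le_rfl (by omega)]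
    rw [Matrix.rank, hlin, hrange]
end

section
/- Let n ≥ 4 and let T_1, …, T_n ∈ GL_{n+1}(ℂ) be invertible matrices satisfying the braid relations, defining an irreducible representation of B_{n+1}. Suppose there exist a nonzero vector v ∈ ℂ^{n+1} and scalars x, y ∈ ℂ such that T_i v = y v for all i = 1, …, n−2 and T_n v = x v. Set θ = T_1 T_2 ⋯ T_n. Then the n−1 vectors v, θv, θ²v, …, θ^{n−2}v are linearly independent in ℂ^{n+1}. -/
/-- The product `T 1 * T 2 * ⋯ * T n`. -/
noncomputable def braidProd {r : ℕ} (T : ℕ → Matrix (Fin r) (Fin r) ℂ) (n : ℕ) :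
    Matrix (Fin r) (Fin r) ℂ :=
  ((List.range n).map fun k => T (k + 1)).prod

theorem braidProd_succ {r : ℕ} (T : ℕ → Matrix (Fin r) (Fin r) ℂ) (k : ℕ) :
    braidProd T (k + 1) = braidProd T k * T (k + 1) := by
  simp [braidProd, List.range_succ]

theorem BraidRels.commute_braidProd {r n : ℕ} {T : ℕ → Matrix (Fin r) (Fin r) ℂ}
    (h : BraidRels (n + 1) T) {j : ℕ} (hj : j ≤ n) :
    ∀ k, k + 2 ≤ j → Commute (braidProd T k) (T j)
  | 0, _ => by simp [braidProd]
  | k + 1, hk => by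
    rw [braidProd_succ]
    exact (h.commute_braidProd hj k (by omega)).mul_left
      (h.2 (k + 1) j (by omega) (by omega) (by omega))

/-- Conjugation by `T 1 * ⋯ * T m` shifts the index of a generator by one. -/
theorem BraidRels.braidProd_semiconjBy {r n : ℕ} {T : ℕ → Matrix (Fin r) (Fin r) ℂ}
    (h : BraidRels (n + 1) T) {i : ℕ} (hi : 1 ≤ i) {m : ℕ} (him : i + 1 ≤ m) (hm : m ≤ n) :
    SemiconjBy (braidProd T m) (T i) (T (i + 1)) := by
  induction m, him using Nat.le_induction with
  | base =>
    obtain ⟨k, rfl⟩ : ∃ k, i = k + 1 := ⟨i - 1, by omega⟩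
    have hc := (h.commute_braidProd hm k le_rfl).eq
    have hb := h.1 (k + 1) hi (by omega)
    rw [SemiconjBy, braidProd_succ, braidProd_succ]
    calc braidProd T k * T (k + 1) * T (k + 1 + 1) * T (k + 1)
        = braidProd T k * (T (k + 1) * T (k + 1 + 1) * T (k + 1)) := by simp only [mul_assoc]
      _ = braidProd T k * T (k + 1 + 1) * (T (k + 1) * T (k + 1 + 1)) := by
          rw [hb]; simp only [mul_assoc]
      _ = T (k + 1 + 1) * (braidProd T k * T (k + 1) * T (k + 1 + 1)) := by
          rw [hc]; simp only [mul_assoc]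
  | succ m him ih =>
    rw [braidProd_succ]
    exact (ih (by omega)).mul_left (h.2 i (m + 1) hi (by omega) (by omega)).symm

theorem BraidRels.braidProd_pow_semiconjBy {r n : ℕ} {T : ℕ → Matrix (Fin r) (Fin r) ℂ}
    (h : BraidRels (n + 1) T) {i : ℕ} (hi : 1 ≤ i) :
    ∀ k, i + k ≤ n → SemiconjBy (braidProd T n ^ k) (T i) (T (i + k))
  | 0, _ => by simp
  | k + 1, hk => by
    rw [pow_succ']
    exact (h.braidProd_semiconjBy (i := i + k) (by omega) (by omega) le_rfl).mul_left
      (h.braidProd_pow_semiconjBy hi k (by omega))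

theorem isUnit_braidProd {r n : ℕ} {T : ℕ → Matrix (Fin r) (Fin r) ℂ}
    (hT : ∀ i, 1 ≤ i → i ≤ n → IsUnit (T i)) : ∀ k ≤ n, IsUnit (braidProd T k)
  | 0, _ => by simp [braidProd]
  | k + 1, hk => by
    rw [braidProd_succ]
    exact (isUnit_braidProd hT k (by omega)).mul (hT (k + 1) (by omega) hk)

theorem Matrix.exists_mulVec_eq_of_invariant {r : ℕ} {A : Matrix (Fin r) (Fin r) ℂ}
    (hA : IsUnit A) {W : Submodule ℂ (Fin r → ℂ)} (hW : ∀ w ∈ W, A.mulVec w ∈ W)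
    {w : Fin r → ℂ} (hw : w ∈ W) : ∃ u ∈ W, A.mulVec u = w := by
  have hinj : Function.Injective (A.mulVecLin.restrict hW) := fun a b hab =>
    Subtype.ext (Matrix.mulVec_injective_of_isUnit hA (congrArg Subtype.val hab))
  obtain ⟨u, hu⟩ := LinearMap.injective_iff_surjective.1 hinj ⟨w, hw⟩
  exact ⟨u, u.2, congrArg Subtype.val hu⟩

/-- A subspace invariant under `T 1 * ⋯ * T n` and under one generator is invariant under all
generators. -/
theorem BraidRels.braidInvariant_of_braidProd {r n : ℕ} {T : ℕ → Matrix (Fin r) (Fin r) ℂ}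
    (h : BraidRels (n + 1) T) (hT : ∀ i, 1 ≤ i → i ≤ n → IsUnit (T i))
    {W : Submodule ℂ (Fin r → ℂ)} (hW : ∀ w ∈ W, (braidProd T n).mulVec w ∈ W)
    {j : ℕ} (hj : 1 ≤ j) (hjn : j ≤ n) (hWj : ∀ w ∈ W, (T j).mulVec w ∈ W) :
    BraidInvariant (n + 1) T W := by
  have hθ := isUnit_braidProd hT n le_rfl
  have hshift : ∀ i k, 1 ≤ i → i + k ≤ n →
      ((∀ w ∈ W, (T i).mulVec w ∈ W) ↔ ∀ w ∈ W, (T (i + k)).mulVec w ∈ W) := by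
    intro i k hi hk
    have hWk : ∀ w ∈ W, (braidProd T n ^ k).mulVec w ∈ W := by
      clear hk
      induction k with
      | zero => simp
      | succ k ih =>
        intro w hw
        rw [pow_succ', ← Matrix.mulVec_mulVec]
        exact hW _ (ih w hw)
    have hsemi (w) : (braidProd T n ^ k).mulVec ((T i).mulVec w) =
        (T (i + k)).mulVec ((braidProd T n ^ k).mulVec w) := by
      simp only [Matrix.mulVec_mulVec, (h.braidProd_pow_semiconjBy hi k hk).eq]
    constructor
    · intro hi w hw
      obtain ⟨u, hu, rfl⟩ := Matrix.exists_mulVec_eq_of_invariant (hθ.pow k) hWk hw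
      rw [← hsemi]
      exact hWk _ (hi u hu)
    · intro hik w hw
      obtain ⟨u, hu, he⟩ := Matrix.exists_mulVec_eq_of_invariant (hθ.pow k) hWk
        (hik _ (hWk w hw))
      rw [← hsemi] at he
      rwa [← Matrix.mulVec_injective_of_isUnit (hθ.pow k) he]
  have hone : ∀ w ∈ W, (T 1).mulVec w ∈ W :=
    (hshift 1 (j - 1) le_rfl (by omega)).2 (by rwa [Nat.add_sub_cancel' hj])
  intro i hi hin
  have := (hshift 1 (i - 1) le_rfl (by omega)).1 hone
  rwa [Nat.add_sub_cancel' hi] at this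

/-- Under the hypotheses of the key theorem, the `n - 1` vectors
`v, θv, θ²v, …, θ^(n-2)v` are linearly independent in `ℂ^(n+1)`. -/
theorem theta_orbit_linearly_independent (n : ℕ) (hn : 4 ≤ n)
    (T : ℕ → Matrix (Fin (n + 1)) (Fin (n + 1)) ℂ)
    (hunit : ∀ i, 1 ≤ i → i ≤ n → IsUnit (T i))
    (hbr : BraidRels (n + 1) T)
    (hirr : BraidIrreducible (n + 1) T)
    (v : Fin (n + 1) → ℂ) (hv : v ≠ 0) (x y : ℂ)
    (hy : ∀ i, 1 ≤ i → i ≤ n - 2 → (T i).mulVec v = y • v)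
    (hx : (T n).mulVec v = x • v) :
    LinearIndependent ℂ fun i : Fin (n - 1) => (braidProd T n ^ (i : ℕ)).mulVec v := by
  suffices H : ∀ m ≤ n - 1,
      LinearIndependent ℂ fun i : Fin m => (braidProd T n ^ (i : ℕ)).mulVec v from H _ le_rfl
  intro m
  induction m with
  | zero => exact fun _ => linearIndependent_empty_type
  | succ m ih =>
    intro hm
    refine linearIndependent_finSucc'.2 ⟨ih (by omega), fun hmem => ?_⟩
    have hθ := isUnit_braidProd hunit n le_rfl
    set W := Submodule.span ℂ
      (Set.range fun i : Fin m => (braidProd T n ^ (i : ℕ)).mulVec v) with hWdef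
    change (braidProd T n ^ m).mulVec v ∈ W at hmem
    have hWθ : ∀ w ∈ W, (braidProd T n).mulVec w ∈ W := by
      refine (Submodule.span_le (p := W.comap (braidProd T n).mulVecLin)).2 ?_
      rintro _ ⟨k, rfl⟩
      change (braidProd T n).mulVec ((braidProd T n ^ (k : ℕ)).mulVec v) ∈ W
      rw [Matrix.mulVec_mulVec, ← pow_succ']
      rcases (Nat.succ_le_of_lt k.2).eq_or_lt with hk | hk
      · rwa [← hk] at hmem
      · exact Submodule.subset_span ⟨⟨k + 1, hk⟩, rfl⟩
    have hWT : ∀ w ∈ W, (T (n - 2)).mulVec w ∈ W := by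
      refine (Submodule.span_le (p := W.comap (T (n - 2)).mulVecLin)).2 ?_
      rintro _ ⟨k, rfl⟩
      have hk := k.2
      have hs := (hbr.braidProd_pow_semiconjBy (i := n - 2 - k) (by omega) k (by omega)).eq
      rw [Nat.sub_add_cancel (by omega)] at hs
      change (T (n - 2)).mulVec ((braidProd T n ^ (k : ℕ)).mulVec v) ∈ W
      rw [Matrix.mulVec_mulVec, ← hs, ← Matrix.mulVec_mulVec, hy _ (by omega) (by omega),
        Matrix.mulVec_smul]
      exact W.smul_mem _ (Submodule.subset_span ⟨k, rfl⟩)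
    rcases hirr W (hbr.braidInvariant_of_braidProd hunit hWθ (by omega) (by omega) hWT)
      with hW | hW
    · rw [hW, Submodule.mem_bot] at hmem
      exact hv (Matrix.mulVec_injective_of_isUnit (hθ.pow m) (by simpa using hmem))
    · have hle := finrank_range_le_card (R := ℂ)
        fun i : Fin m => (braidProd T n ^ (i : ℕ)).mulVec v
      rw [Set.finrank, ← hWdef, hW, finrank_top] at hle
      simp only [Module.finrank_fin_fun, Fintype.card_fin] at hle
      omega
end
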